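/- arXiv:2310.13905 — 2 statements merged into one kernel-verified Lean document; each statement's English description precedes it below -/
import Mathlib

section
/- The Abelian Higgs iteration is well defined and monotone: let ω₂ ∈ l²(ℤⁿ) satisfy ω₂ ≤ 0, Δω₂ = λ e^{ω₂}(e^{ω₂} − 1) + g on ℤⁿ and ω₂(x) → 0 as d(x) → ∞, and fix K > λ. Set u'₀ = 0 and, for k ≥ 1, let u'_k ∈ l²(ℤⁿ) solve (Δ − K)u'_k = λ(e^{u'_{k−1}} − 1) + g − K u'_{k−1} on ℤⁿ with u'_k(x) → 0 as d(x) → ∞. Then for each k ≥ 1 such u'_k exists and is unique, and 0 = u'₀ ≥ u'₁ ≥ u'₂ ≥ … ≥ ω₂ pointwise on ℤⁿ. -/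
open Real

/-- Vertices of the lattice graph `ℤⁿ`. -/
abbrev Zn (n : ℕ) : Type := Fin n → ℤ

/-- The `i`-th standard basis vector. -/
def ee {n : ℕ} (i : Fin n) : Zn n := fun j => if j = i then 1 else 0

/-- `d(x) = d(x,0) = ∑ |xᵢ|`. -/
def dd {n : ℕ} (x : Zn n) : ℕ := ∑ i, (x i).natAbs

/-- The set of neighbors of `x`, i.e. `{y : d(x,y) = 1}`. -/
def nbrs {n : ℕ} (x : Zn n) : Finset (Zn n) :=
  (Finset.image (fun i : Fin n => x + ee i) Finset.univ) ∪
  (Finset.image (fun i : Fin n => x - ee i) Finset.univ)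

/-- The graph Laplacian `Δu(x) = ∑_{y ~ x} (u(y) - u(x))`. -/
def lap {n : ℕ} (u : Zn n → ℝ) (x : Zn n) : ℝ := ∑ y ∈ nbrs x, (u y - u x)

/-- The vertex boundary `δΩ` of a finite set `Ω ⊂ ℤⁿ`. -/
def bdry {n : ℕ} (Ω : Finset (Zn n)) : Finset (Zn n) := Ω.biUnion nbrs \ Ω

/-- `Ω̄ = Ω ∪ δΩ`. -/
def clos {n : ℕ} (Ω : Finset (Zn n)) : Finset (Zn n) := Ω ∪ bdry Ω

/-- Sums over the neighbors of `x` split along the coordinate directions. -/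
lemma sum_nbrs {n : ℕ} (F : Zn n → ℝ) (x : Zn n) :
    ∑ y ∈ nbrs x, F y = ∑ i, (F (x + ee i) + F (x - ee i)) := by
  have ee_inj : Function.Injective (ee : Fin n → Zn n) := by
    intro i j h
    by_contra hij
    have := congrFun h i
    simp [ee, hij] at this
  unfold nbrs
  rw [Finset.sum_union, Finset.sum_image, Finset.sum_image, Finset.sum_add_distrib]
  · intro i _ j _ h
    exact ee_inj (sub_right_injective h)
  · intro i _ j _ h
    exact ee_inj (add_right_injective x h)
  · rw [Finset.disjoint_left]
    intro y hy hy'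
    obtain ⟨i, -, rfl⟩ := Finset.mem_image.1 hy
    obtain ⟨j, -, hj⟩ := Finset.mem_image.1 hy'
    have := congrFun hj i
    simp only [Pi.sub_apply, Pi.add_apply, ee] at this
    split_ifs at this <;> omega

lemma lap_eq {n : ℕ} (u : Zn n → ℝ) (x : Zn n) :
    lap u x = ∑ i, (u (x + ee i) + u (x - ee i)) - 2 * n * u x := by
  unfold lap
  rw [sum_nbrs (fun y => u y - u x), show 2 * n * u x = ∑ _i : Fin n, 2 * u x by simp; ring,
    ← Finset.sum_sub_distrib]
  exact Finset.sum_congr rfl fun i _ => by ring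

lemma lap_sub {n : ℕ} (u v : Zn n → ℝ) (x : Zn n) :
    lap (fun y => u y - v y) x = lap u x - lap v x := by
  simp only [lap, ← Finset.sum_sub_distrib]
  exact Finset.sum_congr rfl fun y _ => by ring

lemma memℓp_two_iff {α : Type*} {f : α → ℝ} :
    Memℓp f 2 ↔ Summable fun x => f x ^ 2 := by
  rw [memℓp_gen_iff (by norm_num)]
  simp

lemma Memℓp.finite_le_abs {α : Type*} {f : α → ℝ} (hf : Memℓp f 2) {ε : ℝ} (hε : 0 < ε) :
    {x | ε ≤ |f x|}.Finite := by
  have h := (memℓp_two_iff.1 hf).tendsto_cofinite_zero.eventually_lt_const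
    (show (0 : ℝ) < ε ^ 2 by positivity)
  refine (Filter.eventually_cofinite.1 h).subset fun x hx => ?_
  have : ε ^ 2 ≤ |f x| ^ 2 := pow_le_pow_left₀ hε.le hx 2
  simpa using this

/-- Square-summable functions on the lattice vanish at infinity. -/
lemma Memℓp.exists_abs_lt {n : ℕ} {f : Zn n → ℝ} (hf : Memℓp f 2) {ε : ℝ} (hε : 0 < ε) :
    ∃ R : ℕ, ∀ x : Zn n, R ≤ dd x → |f x| < ε := by
  obtain ⟨B, hB⟩ := ((hf.finite_le_abs hε).image dd).bddAbove
  refine ⟨B + 1, fun x hx => ?_⟩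
  by_contra! h
  have := hB (Set.mem_image_of_mem dd h)
  omega

/-- The maximum principle for `Δ - K` on `l²`. -/
lemma nonpos_of_mul_le_lap {n : ℕ} {K : ℝ} (hK : 0 < K) {w : Zn n → ℝ} (hw : Memℓp w 2)
    (h : ∀ x, K * w x ≤ lap w x) (x : Zn n) : w x ≤ 0 := by
  by_contra! hx
  have hfin : {y | w x ≤ w y}.Finite :=
    (hw.finite_le_abs hx).subset fun y (hy : w x ≤ w y) => hy.trans (le_abs_self _)
  obtain ⟨z, hz, hmax⟩ := Set.exists_max_image _ w hfin ⟨x, le_refl (w x)⟩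
  have hz' : w x ≤ w z := hz
  have hle : lap w z ≤ 0 := Finset.sum_nonpos fun y _ => by
    rcases le_total (w x) (w y) with hy | hy
    · linarith [hmax y hy]
    · linarith
  nlinarith [h z]

lemma Memℓp.comp_add_right {G : Type*} [AddGroup G] {u : G → ℝ} (hu : Memℓp u 2) (a : G) :
    Memℓp (fun x => u (x + a)) 2 :=
  memℓp_two_iff.2 ((memℓp_two_iff.1 hu).comp_injective (add_left_injective a))

/-- Translation by `a` as a linear isometry of `l²`. -/
noncomputable def lpTranslate {G : Type*} [AddGroup G] (a : G) :
    lp (fun _ : G => ℝ) 2 →ₗᵢ[ℝ] lp (fun _ : G => ℝ) 2 where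
  toFun u := ⟨fun x => u (x + a), (lp.memℓp u).comp_add_right a⟩
  map_add' _ _ := rfl
  map_smul' _ _ := rfl
  norm_map' u := by
    have h2 : 0 < (2 : ENNReal).toReal := by norm_num
    rw [lp.norm_eq_tsum_rpow h2, lp.norm_eq_tsum_rpow h2 u]
    exact congrArg (· ^ (1 / (2 : ENNReal).toReal))
      ((Equiv.addRight a).tsum_eq fun x => ‖u x‖ ^ (2 : ENNReal).toReal)

@[simp]
lemma lpTranslate_apply {G : Type*} [AddGroup G] (a : G) (u : lp (fun _ : G => ℝ) 2) (x : G) :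
    lpTranslate a u x = u (x + a) :=
  rfl

/-- The equation `(Δ - K) v = f` is solvable in `l²`. -/
lemma exists_memℓp_lap_sub_eq {n : ℕ} {K : ℝ} (hK : 0 < K) {f : Zn n → ℝ} (hf : Memℓp f 2) :
    ∃ v : Zn n → ℝ, Memℓp v 2 ∧ ∀ x, lap v x - K * v x = f x := by
  have hpos : 0 < 2 * (n : ℝ) + K := by positivity
  let f' : lp (fun _ : Zn n => ℝ) 2 := ⟨f, hf⟩
  let A (u : lp (fun _ : Zn n => ℝ) 2) : lp (fun _ : Zn n => ℝ) 2 :=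
    ∑ i, (lpTranslate (ee i) u + lpTranslate (-ee i) u)
  let T (u : lp (fun _ : Zn n => ℝ) 2) : lp (fun _ : Zn n => ℝ) 2 :=
    (2 * (n : ℝ) + K)⁻¹ • (A u - f')
  have hA (u v) : ‖A u - A v‖ ≤ 2 * n * ‖u - v‖ := by
    have : A u - A v = ∑ i, (lpTranslate (ee i) (u - v) + lpTranslate (-ee i) (u - v)) := by
      simp only [A, ← Finset.sum_sub_distrib, map_sub]
      exact Finset.sum_congr rfl fun i _ => by abel
    rw [this]
    refine (norm_sum_le_of_le _ (f := fun i => lpTranslate (ee i) (u - v) + lpTranslate (-ee i) (u - v))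
      (n := fun _ => 2 * ‖u - v‖) fun i _ => ?_).trans_eq ?_
    · refine (norm_add_le _ _).trans_eq ?_
      rw [LinearIsometry.norm_map, LinearIsometry.norm_map]
      ring
    · simp
      ring
  have hT : ContractingWith (2 * n * (2 * (n : ℝ) + K)⁻¹).toNNReal T := by
    have h0 : 0 ≤ 2 * n * (2 * (n : ℝ) + K)⁻¹ := by positivity
    refine ⟨?_, LipschitzWith.of_dist_le_mul fun u v => ?_⟩
    · rw [Real.toNNReal_lt_one, ← div_eq_mul_inv, div_lt_one hpos]
      linarith
    · rw [Real.coe_toNNReal _ h0, dist_eq_norm, dist_eq_norm, ← smul_sub, norm_smul,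
        sub_sub_sub_cancel_right, Real.norm_of_nonneg (inv_nonneg.2 hpos.le)]
      calc _ ≤ (2 * (n : ℝ) + K)⁻¹ * (2 * n * ‖u - v‖) := by gcongr; exact hA u v
        _ = _ := by ring
  obtain ⟨u, hu⟩ : ∃ u, T u = u := ⟨_, hT.fixedPoint_isFixedPt⟩
  refine ⟨u, lp.memℓp u, fun x => ?_⟩
  have hx : (2 * (n : ℝ) + K)⁻¹ * (∑ i, (u (x + ee i) + u (x - ee i)) - f x) = u x := by
    have := congrArg (fun w : lp (fun _ : Zn n => ℝ) 2 => w x) hu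
    simp only [T, A, f', lp.coeFn_smul, lp.coeFn_sub, lp.coeFn_sum, lp.coeFn_add, Pi.smul_apply,
      Pi.sub_apply, Finset.sum_apply, Pi.add_apply, lpTranslate_apply, smul_eq_mul,
      ← sub_eq_add_neg] at this
    exact this
  rw [inv_mul_eq_iff_eq_mul₀ hpos.ne'] at hx
  rw [lap_eq]
  linarith

lemma exp_sub_exp_le {a b : ℝ} (hab : a ≤ b) (hb : b ≤ 0) : exp b - exp a ≤ b - a := by
  have h1 : exp a = exp b * exp (a - b) := by rw [← exp_add]; ring_nf
  have h2 : exp b ≤ 1 := exp_le_one_iff.2 hb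
  nlinarith [add_one_le_exp (a - b), exp_pos b]

lemma memℓp_exp_sub_one {α : Type*} {u : α → ℝ} (hu : Memℓp u 2) (hu0 : ∀ x, u x ≤ 0) :
    Memℓp (fun x => exp (u x) - 1) 2 := by
  refine memℓp_two_iff.2 (.of_nonneg_of_le (fun _ => sq_nonneg _) (fun x => ?_)
    (memℓp_two_iff.1 hu))
  rw [sq_le_sq, abs_of_nonpos (hu0 x), abs_of_nonpos (by simpa using hu0 x)]
  linarith [add_one_le_exp (u x)]

/-- `t ↦ lam (eᵗ - 1) - K t` is antitone on the nonpositive reals when `lam ≤ K`. -/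
lemma exp_sub_mul_antitone {lam K a b : ℝ} (hlam : 0 ≤ lam) (hK : lam ≤ K) (hab : a ≤ b)
    (hb : b ≤ 0) : lam * (exp b - 1) - K * b ≤ lam * (exp a - 1) - K * a := by
  nlinarith [mul_le_mul_of_nonneg_left (exp_sub_exp_le hab hb) hlam,
    mul_le_mul_of_nonneg_right hK (sub_nonneg.2 hab)]

/-- The Abelian Higgs iteration on `ℤⁿ` is well defined and monotone, and stays
above the subsolution `ω₂`. -/
theorem stmt18 (n : ℕ) (hn : 2 ≤ n) (lam : ℝ) (hlam : 0 < lam)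
    (M : ℕ) (hM : 1 ≤ M) (nn : Fin M → ℕ) (hnn : ∀ j, 0 < nn j)
    (p : Fin M → Zn n) (hp : Function.Injective p)
    (g : Zn n → ℝ)
    (hg : ∀ x, g x = ∑ j, if x = p j then 4 * Real.pi * (nn j : ℝ) else 0)
    (K : ℝ) (hK : lam < K)
    (ω₂ : Zn n → ℝ)
    (hω₂l2 : Summable (fun x : Zn n => ω₂ x ^ 2))
    (hω₂neg : ∀ x, ω₂ x ≤ 0)
    (hω₂eq : ∀ x, lap ω₂ x = lam * (Real.exp (ω₂ x) * (Real.exp (ω₂ x) - 1)) + g x)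
    (hω₂lim : ∀ ε : ℝ, 0 < ε → ∃ R : ℕ, ∀ x : Zn n, R ≤ dd x → |ω₂ x| < ε) :
    ∃ U : ℕ → Zn n → ℝ,
      -- u'₀ = 0
      (∀ x, U 0 x = 0) ∧
      -- each u'ₖ, k ≥ 1, is an l² solution of the iteration step, tending to 0 at infinity
      (∀ k : ℕ, Summable (fun x : Zn n => U (k + 1) x ^ 2)) ∧
      (∀ k : ℕ, ∀ x : Zn n,
        lap (U (k + 1)) x - K * U (k + 1) x
          = lam * (Real.exp (U k x) - 1) + g x - K * U k x) ∧
      (∀ k : ℕ, ∀ ε : ℝ, 0 < ε → ∃ R : ℕ, ∀ x : Zn n, R ≤ dd x → |U (k + 1) x| < ε) ∧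
      -- uniqueness of each iteration step
      (∀ k : ℕ, ∀ v : Zn n → ℝ, Summable (fun x : Zn n => v x ^ 2) →
        (∀ x : Zn n, lap v x - K * v x
          = lam * (Real.exp (U k x) - 1) + g x - K * U k x) →
        (∀ ε : ℝ, 0 < ε → ∃ R : ℕ, ∀ x : Zn n, R ≤ dd x → |v x| < ε) →
        ∀ x, v x = U (k + 1) x) ∧
      -- monotonicity: 0 = u'₀ ≥ u'₁ ≥ u'₂ ≥ … ≥ ω₂
      (∀ k : ℕ, ∀ x, U (k + 1) x ≤ U k x) ∧
      (∀ k : ℕ, ∀ x, ω₂ x ≤ U k x) := by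
  have hK0 : 0 < K := hlam.trans hK
  have hω : Memℓp ω₂ 2 := memℓp_two_iff.2 hω₂l2
  have hg0 (x) : 0 ≤ g x := by
    rw [hg]
    exact Finset.sum_nonneg fun j _ => by split_ifs <;> positivity
  have hgl2 : Memℓp g 2 := by
    refine memℓp_two_iff.2 (summable_of_ne_finset_zero (s := Finset.univ.image p) fun x hx => ?_)
    have : g x = 0 := by
      rw [hg]
      refine Finset.sum_eq_zero fun j _ => if_neg ?_
      rintro rfl
      exact hx (Finset.mem_image_of_mem p (Finset.mem_univ j))
    simp [this]
  have hsolve (f : Zn n → ℝ) :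
      ∃ v : Zn n → ℝ, Memℓp f 2 → Memℓp v 2 ∧ ∀ x, lap v x - K * v x = f x := by
    by_cases hf : Memℓp f 2
    · obtain ⟨v, hv⟩ := exists_memℓp_lap_sub_eq hK0 hf
      exact ⟨v, fun _ => hv⟩
    · exact ⟨0, fun h => absurd h hf⟩
  choose S hS using hsolve
  let F (u : Zn n → ℝ) (x : Zn n) : ℝ := lam * (exp (u x) - 1) + g x - K * u x
  let U (k : ℕ) : Zn n → ℝ := (fun u => S (F u))^[k] 0
  have hU (k) : U (k + 1) = S (F (U k)) := Function.iterate_succ_apply' _ k 0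
  have hF {u : Zn n → ℝ} (hu : Memℓp u 2) (hu0 : ∀ x, u x ≤ 0) : Memℓp (F u) 2 :=
    (((memℓp_exp_sub_one hu hu0).const_mul lam).add hgl2).sub (hu.const_mul K)
  have hstep {k} (hu : Memℓp (U k) 2) (hu0 : ∀ x, U k x ≤ 0) :
      Memℓp (U (k + 1)) 2 ∧ ∀ x, lap (U (k + 1)) x - K * U (k + 1) x = F (U k) x := by
    rw [hU]
    exact hS _ (hF hu hu0)
  have hU0 (x) : U 0 x = 0 := rfl
  have hcmp {u v : Zn n → ℝ} (hu : Memℓp u 2) (hv : Memℓp v 2)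
      (h : ∀ x, lap v x - K * v x ≤ lap u x - K * u x) (x) : u x ≤ v x := by
    refine sub_nonpos.1 (nonpos_of_mul_le_lap hK0 (hu.sub hv) (fun y => ?_) x)
    change K * (u y - v y) ≤ lap (fun z => u z - v z) y
    rw [lap_sub]
    linarith [h y]
  have key (k) : Memℓp (U k) 2 ∧ (∀ x, U k x ≤ 0) ∧ (∀ x, ω₂ x ≤ U k x) ∧
      ∀ x, U (k + 1) x ≤ U k x := by
    induction k with
    | zero =>
      have hm : Memℓp (U 0) 2 := zero_memℓp
      refine ⟨hm, fun x => (hU0 x).le, hω₂neg, ?_⟩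
      obtain ⟨hm1, he⟩ := hstep hm fun x => (hU0 x).le
      refine hcmp hm1 hm fun x => ?_
      rw [he]
      simp [F, hU0, lap, hg0 x]
    | succ k ih =>
      obtain ⟨hm, hneg, hlow, hmono⟩ := ih
      obtain ⟨hm1, he⟩ := hstep hm hneg
      have hneg1 (x) : U (k + 1) x ≤ 0 := (hmono x).trans (hneg x)
      obtain ⟨hm2, he2⟩ := hstep hm1 hneg1
      refine ⟨hm1, hneg1, hcmp hω hm1 fun x => ?_, hcmp hm2 hm1 fun x => ?_⟩
      · rw [he, hω₂eq]
        have := exp_sub_mul_antitone hlam.le hK.le (hlow x) (hneg x)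
        have := mul_nonneg hlam.le (sq_nonneg (exp (ω₂ x) - 1))
        simp only [F]
        linarith
      · rw [he, he2]
        have := exp_sub_mul_antitone hlam.le hK.le (hmono x) (hneg x)
        simp only [F]
        linarith
  have hsucc (k) := hstep (key k).1 (key k).2.1
  refine ⟨U, hU0, fun k => memℓp_two_iff.1 (hsucc k).1, fun k => (hsucc k).2,
    fun k ε hε => (hsucc k).1.exists_abs_lt hε, fun k v hv hveq _ x => ?_,
    fun k => (key k).2.2.2, fun k => (key k).2.2.1⟩
  have hv := memℓp_two_iff.2 hv
  have heq (y) : lap v y - K * v y = lap (U (k + 1)) y - K * U (k + 1) y :=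
    (hveq y).trans ((hsucc k).2 y).symm
  exact le_antisymm (hcmp hv (hsucc k).1 (fun y => (heq y).ge) x)
    (hcmp (hsucc k).1 hv (fun y => (heq y).le) x)
end

section
/- Exponential barrier estimate: let β > 0 and define h : ℤⁿ → ℝ by h(x) = −e^{−β d(x)}. Then for every x ∈ ℤⁿ with d(x) ≥ 1, Δh(x) ≥ n(e^{β} + e^{−β} − 2) h(x). -/
open Real

lemma ee_injective {n : ℕ} : Function.Injective (ee : Fin n → Zn n) := by
  intro i j hij
  have := congrFun hij i
  by_contra hne
  simp [ee, hne] at this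

lemma add_ee_ne_sub_ee {n : ℕ} (x : Zn n) (i j : Fin n) : x + ee i ≠ x - ee j := by
  intro hij
  have := congrFun hij i
  simp only [ee, Pi.add_apply, Pi.sub_apply, if_true] at this
  split_ifs at this <;> omega

/-- The Laplacian as a sum of second differences along the coordinate axes. -/
lemma lap_eq_sum {n : ℕ} (u : Zn n → ℝ) (x : Zn n) :
    lap u x = ∑ i, (u (x + ee i) + u (x - ee i) - 2 * u x) := by
  have hdisj : Disjoint (Finset.image (fun i : Fin n => x + ee i) Finset.univ)
      (Finset.image (fun i : Fin n => x - ee i) Finset.univ) := by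
    rw [Finset.disjoint_left]
    intro y hy hy'
    obtain ⟨i, -, rfl⟩ := Finset.mem_image.1 hy
    obtain ⟨j, -, hj⟩ := Finset.mem_image.1 hy'
    exact add_ee_ne_sub_ee x i j hj.symm
  rw [lap, nbrs, Finset.sum_union hdisj,
    Finset.sum_image fun i _ j _ hij => ee_injective (add_left_cancel hij),
    Finset.sum_image fun i _ j _ hij => ee_injective (sub_right_injective hij),
    ← Finset.sum_add_distrib]
  exact Finset.sum_congr rfl fun i _ => by ring

lemma dd_add_natAbs {n : ℕ} {x y : Zn n} (i : Fin n) (hxy : ∀ j, j ≠ i → y j = x j) :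
    dd y + (x i).natAbs = dd x + (y i).natAbs := by
  have hsum : ∑ j ∈ Finset.univ.erase i, (y j).natAbs =
      ∑ j ∈ Finset.univ.erase i, (x j).natAbs :=
    Finset.sum_congr rfl fun j hj => by rw [hxy j (Finset.ne_of_mem_erase hj)]
  rw [dd, dd, ← Finset.add_sum_erase _ _ (Finset.mem_univ i),
    ← Finset.add_sum_erase _ (fun j => (x j).natAbs) (Finset.mem_univ i), hsum]
  ring

lemma dd_add_ee {n : ℕ} (x : Zn n) (i : Fin n) :
    dd (x + ee i) + (x i).natAbs = dd x + (x i + 1).natAbs := by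
  simpa [ee] using dd_add_natAbs (x := x) (y := x + ee i) i fun j hj => by simp [ee, hj]

lemma dd_sub_ee {n : ℕ} (x : Zn n) (i : Fin n) :
    dd (x - ee i) + (x i).natAbs = dd x + (x i - 1).natAbs := by
  simpa [ee] using dd_add_natAbs (x := x) (y := x - ee i) i fun j hj => by simp [ee, hj]

/-- Among the two neighbors of `x` along an axis, one is farther from the origin than `x`, and the
other is either nearer or farther. -/
lemma dd_neighbors {n : ℕ} (x : Zn n) (i : Fin n) :
    (dd (x + ee i) = dd x + 1 ∧ dd (x - ee i) + 1 = dd x) ∨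
    (dd (x + ee i) + 1 = dd x ∧ dd (x - ee i) = dd x + 1) ∨
    (dd (x + ee i) = dd x + 1 ∧ dd (x - ee i) = dd x + 1) := by
  have hadd := dd_add_ee x i
  have hsub := dd_sub_ee x i
  omega

lemma exp_dd_neighbors_le {n : ℕ} {β : ℝ} (hβ : 0 ≤ β) (x : Zn n) (i : Fin n) :
    Real.exp (-β * (dd (x + ee i) : ℝ)) + Real.exp (-β * (dd (x - ee i) : ℝ)) ≤
      (Real.exp β + Real.exp (-β)) * Real.exp (-β * (dd x : ℝ)) := by
  have far {m k : ℕ} (hm : m = k + 1) :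
      Real.exp (-β * (m : ℝ)) = Real.exp (-β) * Real.exp (-β * (k : ℝ)) := by
    rw [hm, ← Real.exp_add]
    push_cast
    ring_nf
  have near {m k : ℕ} (hm : m + 1 = k) :
      Real.exp (-β * (m : ℝ)) = Real.exp β * Real.exp (-β * (k : ℝ)) := by
    rw [← hm, ← Real.exp_add]
    push_cast
    ring_nf
  rcases dd_neighbors x i with ⟨hp, hm⟩ | ⟨hp, hm⟩ | ⟨hp, hm⟩
  · rw [far hp, near hm]
    linarith
  · rw [near hp, far hm]
    linarith
  · rw [far hp, far hm, ← add_mul]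
    gcongr
    linarith

/-- Exponential barrier estimate: for `h(x) = -e^{-β d(x)}` and `d(x) ≥ 1`,
`Δh(x) ≥ n (e^β + e^{-β} - 2) h(x)`. -/
theorem stmt19 (n : ℕ) (hn : 2 ≤ n) (β : ℝ) (hβ : 0 < β)
    (h : Zn n → ℝ) (hh : ∀ x, h x = -Real.exp (-β * (dd x : ℝ))) :
    ∀ x : Zn n, 1 ≤ dd x →
      (n : ℝ) * (Real.exp β + Real.exp (-β) - 2) * h x ≤ lap h x := by
  intro x _
  calc (n : ℝ) * (Real.exp β + Real.exp (-β) - 2) * h x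
      = ∑ _i : Fin n, (Real.exp β + Real.exp (-β) - 2) * h x := by simp [mul_assoc]
    _ ≤ ∑ i, (h (x + ee i) + h (x - ee i) - 2 * h x) := by
        refine Finset.sum_le_sum fun i _ => ?_
        have hi := exp_dd_neighbors_le hβ.le x i
        simp only [hh]
        linarith
    _ = lap h x := (lap_eq_sum h x).symm
end
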